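/- (Ground state transform / Jacobi identity.) Let Ω ⊆ ℝ^N be an open set, let V : Ω → ℝ be continuous, and let v : Ω → ℝ be twice continuously differentiable with v(x) > 0 and Δv(x) + V(x) v(x) = 0 for all x ∈ Ω, where Δ denotes the sum of the second partial derivatives. Then for every u ∈ C_c^∞(Ω): ∫_Ω |∇u(x)|² dx − ∫_Ω V(x) u(x)² dx = ∫_Ω v(x)² |∇(u/v)(x)|² dx. -/

import Mathlib

open MeasureTheory Real Set Filter

noncomputable section

abbrev EN (N : ℕ) := EuclideanSpace ℝ (Fin N)

/-- `u ∈ C_c^∞(Ω)`: smooth with compact support contained in `Ω`. -/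
def IsTestFun (N : ℕ) (Ω : Set (EN N)) (u : EN N → ℝ) : Prop :=
  ContDiff ℝ (⊤ : ℕ∞) u ∧ IsCompact (tsupport u) ∧ tsupport u ⊆ Ω

/-- The Laplacian as the sum of second partial derivatives. -/
def laplacian (N : ℕ) (v : EN N → ℝ) (x : EN N) : ℝ :=
  ∑ i : Fin N, fderiv ℝ (fun y => fderiv ℝ v y (EuclideanSpace.single i (1 : ℝ))) x
    (EuclideanSpace.single i (1 : ℝ))

/-- A function continuous on `Ω` and vanishing outside a compact subset of `Ω` is integrable. -/
lemma ContinuousOn.integrable_of_eq_zero_off_compact {E : Type*} [TopologicalSpace E] [T2Space E]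
    [MeasurableSpace E] [OpensMeasurableSpace E] {μ : Measure E} [IsFiniteMeasureOnCompacts μ]
    {Ω K : Set E} {h : E → ℝ} (hh : ContinuousOn h Ω) (hK : IsCompact K) (hKΩ : K ⊆ Ω)
    (h0 : ∀ x ∉ K, h x = 0) : Integrable h μ := by
  rw [← integrableOn_iff_integrable_of_support_subset (s := K)
    (fun x hx => by_contra fun hxK => hx (h0 x hxK))]
  exact (hh.mono hKΩ).integrableOn_compact hK

/-- The dual norm on Euclidean space is the Euclidean norm of the coefficients. -/
lemma EuclideanSpace.norm_sq_dual_eq_sum {ι : Type*} [Fintype ι] [DecidableEq ι]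
    (L : EuclideanSpace ℝ ι →L[ℝ] ℝ) :
    ‖L‖ ^ 2 = ∑ i, L (EuclideanSpace.single i (1 : ℝ)) ^ 2 := by
  set w := (InnerProductSpace.toDual ℝ (EuclideanSpace ℝ ι)).symm L with hw
  have h1 : ‖L‖ = ‖w‖ := by simp [hw]
  have h2 (i : ι) : L (EuclideanSpace.single i (1 : ℝ)) = w i := by
    rw [← InnerProductSpace.toDual_symm_apply (𝕜 := ℝ) (y := L), ← hw]
    simp [EuclideanSpace.inner_single_right]
  simp only [h1, h2, EuclideanSpace.norm_sq_eq, Real.norm_eq_abs, sq_abs]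

/-- The derivative of a function vanishes off any closed set outside of which it is zero. -/
lemma hasFDerivAt_zero_of_eq_zero_off_closed {E : Type*} [NormedAddCommGroup E] [NormedSpace ℝ E]
    {K : Set E} (hK : IsClosed K) {h : E → ℝ} (h0 : ∀ x ∉ K, h x = 0) {x : E} (hx : x ∉ K) :
    HasFDerivAt h (0 : E →L[ℝ] ℝ) x :=
  (hasFDerivAt_const (0 : ℝ) x).congr_of_eventuallyEq <| by
    filter_upwards [hK.isOpen_compl.mem_nhds hx] with y hy using h0 y hy

/-- Pointwise Jacobi identity, in a single direction. -/
lemma sq_mul_fderiv_div_sq {E : Type*} [NormedAddCommGroup E] [NormedSpace ℝ E]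
    {u v : E → ℝ} {x : E} (hu : DifferentiableAt ℝ u x) (hv : DifferentiableAt ℝ v x)
    (hvx : v x ≠ 0) (e : E) :
    v x ^ 2 * (fderiv ℝ (fun y => u y / v y) x e) ^ 2 =
      fderiv ℝ u x e ^ 2 - fderiv ℝ (fun y => u y ^ 2 / v y) x e * fderiv ℝ v x e := by
  have hinv := (hasDerivAt_inv hvx).comp_hasFDerivAt x hv.hasFDerivAt
  have h1 : fderiv ℝ (fun y => u y / v y) x = _ := (hu.hasFDerivAt.mul hinv).fderiv
  have h2 : fderiv ℝ (fun y => u y ^ 2 / v y) x = _ :=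
    ((hu.hasFDerivAt.pow 2).mul hinv).fderiv
  rw [h1, h2]
  simp
  field_simp
  ring

/-- Ground state transform / Jacobi identity: if `v ∈ C²(Ω)` is positive
and satisfies `Δv + V v = 0` on `Ω`, then for every `u ∈ C_c^∞(Ω)`,
`∫_Ω |∇u|² - ∫_Ω V u² = ∫_Ω v² |∇(u/v)|²`. -/
theorem ground_state_transform (N : ℕ) (Ω : Set (EN N)) (hO : IsOpen Ω)
    (V : EN N → ℝ) (hVc : ContinuousOn V Ω)
    (v : EN N → ℝ) (hv : ContDiffOn ℝ 2 v Ω)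
    (hvpos : ∀ x ∈ Ω, 0 < v x)
    (hveq : ∀ x ∈ Ω, laplacian N v x + V x * v x = 0)
    (u : EN N → ℝ) (hu : IsTestFun N Ω u) :
    (∫ x in Ω, ‖fderiv ℝ u x‖ ^ 2) - (∫ x in Ω, V x * u x ^ 2) =
      ∫ x in Ω, v x ^ 2 * ‖fderiv ℝ (fun y => u y / v y) x‖ ^ 2 := by
  obtain ⟨hus, huc, huΩ⟩ := hu
  set K := tsupport u
  have hKcl : IsClosed K := isClosed_tsupport u
  have hu0 : ∀ x ∉ K, u x = 0 := fun x hx => image_eq_zero_of_notMem_tsupport hx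
  have hvne : ∀ x ∈ Ω, v x ≠ 0 := fun x hx => (hvpos x hx).ne'
  have hu2 : ContDiff ℝ 2 u := contDiff_infty.1 hus 2
  set f : EN N → ℝ := fun y => u y ^ 2 / v y with hf
  set q : EN N → ℝ := fun y => u y / v y with hq
  let e : Fin N → EN N := fun i => EuclideanSpace.single i (1 : ℝ)
  have hf0 : ∀ x ∉ K, f x = 0 := fun x hx => by simp [hf, hu0 x hx]
  have hq0 : ∀ x ∉ K, q x = 0 := fun x hx => by simp [hq, hu0 x hx]
  have hfC : ContDiffOn ℝ 2 f Ω := (hu2.pow 2).contDiffOn.div hv hvne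
  have hPC (i : Fin N) : ContDiffOn ℝ 1 (fun y => fderiv ℝ v y (e i)) Ω :=
    (hv.fderiv_of_isOpen hO (by norm_num)).clm_apply contDiffOn_const
  have hvD : ∀ x ∈ Ω, DifferentiableAt ℝ v x := fun x hx =>
    (hv.differentiableOn (by norm_num)).differentiableAt (hO.mem_nhds hx)
  have hfD (x : EN N) : DifferentiableAt ℝ f x := by
    by_cases hx : x ∈ K
    · exact (hfC.differentiableOn (by norm_num)).differentiableAt (hO.mem_nhds (huΩ hx))
    · exact (hasFDerivAt_zero_of_eq_zero_off_closed hKcl hf0 hx).differentiableAt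
  have hfK : tsupport f ⊆ K :=
    closure_minimal (fun x hx => by_contra fun hxK => hx (hf0 x hxK)) hKcl
  have hdu0 : ∀ x ∉ K, fderiv ℝ u x = 0 := fun x hx =>
    (hasFDerivAt_zero_of_eq_zero_off_closed hKcl hu0 hx).fderiv
  have hdf0 : ∀ x ∉ K, fderiv ℝ f x = 0 := fun x hx =>
    (hasFDerivAt_zero_of_eq_zero_off_closed hKcl hf0 hx).fderiv
  have hdq0 : ∀ x ∉ K, fderiv ℝ q x = 0 := fun x hx =>
    (hasFDerivAt_zero_of_eq_zero_off_closed hKcl hq0 hx).fderiv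
  have hduC : ContinuousOn (fderiv ℝ u) Ω :=
    hu2.contDiffOn.continuousOn_fderiv_of_isOpen hO (by norm_num)
  have hdfC : ContinuousOn (fderiv ℝ f) Ω := hfC.continuousOn_fderiv_of_isOpen hO (by norm_num)
  have hdu_int : Integrable (fun x => ‖fderiv ℝ u x‖ ^ 2) :=
    (hduC.norm.pow 2).integrable_of_eq_zero_off_compact huc huΩ
      fun x hx => by simp [hdu0 x hx]
  have hVu_int : Integrable (fun x => V x * u x ^ 2) :=
    (hVc.mul (hu2.continuous.continuousOn.pow 2)).integrable_of_eq_zero_off_compact huc huΩ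
      fun x hx => by simp [hu0 x hx]
  have hdfdv_int (i : Fin N) : Integrable (fun x => fderiv ℝ f x (e i) * fderiv ℝ v x (e i)) :=
    ((hdfC.clm_apply continuousOn_const).mul
      (hPC i).continuousOn).integrable_of_eq_zero_off_compact huc huΩ
      fun x hx => by simp [hdf0 x hx]
  have hfddv_int (i : Fin N) : Integrable
      (fun x => f x * fderiv ℝ (fun y => fderiv ℝ v y (e i)) x (e i)) :=
    (hfC.continuousOn.mul (((hPC i).continuousOn_fderiv_of_isOpen hO le_rfl).clm_apply
      continuousOn_const)).integrable_of_eq_zero_off_compact huc huΩ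
      fun x hx => by simp [hf0 x hx]
  have hfdv_int (i : Fin N) : Integrable (fun x => f x * fderiv ℝ v x (e i)) :=
    (hfC.continuousOn.mul (hPC i).continuousOn).integrable_of_eq_zero_off_compact huc huΩ
      fun x hx => by simp [hf0 x hx]
  have hdiv_int (i : Fin N) : Integrable (fun x => fderiv ℝ f x (e i) * fderiv ℝ v x (e i) +
      f x * fderiv ℝ (fun y => fderiv ℝ v y (e i)) x (e i)) := (hdfdv_int i).add (hfddv_int i)
  have parts (i : Fin N) :
      ∫ x, (fderiv ℝ f x (e i) * fderiv ℝ v x (e i) +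
        f x * fderiv ℝ (fun y => fderiv ℝ v y (e i)) x (e i)) = 0 := by
    rw [integral_add (hdfdv_int i) (hfddv_int i),
      integral_mul_fderiv_eq_neg_fderiv_mul_of_integrable (hdfdv_int i) (hfddv_int i) (hfdv_int i)
        (fun x _ => hfD x) (fun x hx => ((hPC i).differentiableOn (by norm_num)).differentiableAt
          (hO.mem_nhds (huΩ (hfK hx)))), add_neg_cancel]
  have key (x : EN N) : v x ^ 2 * ‖fderiv ℝ q x‖ ^ 2 =
      (‖fderiv ℝ u x‖ ^ 2 - V x * u x ^ 2) -
      ∑ i, (fderiv ℝ f x (e i) * fderiv ℝ v x (e i) +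
        f x * fderiv ℝ (fun y => fderiv ℝ v y (e i)) x (e i)) := by
    by_cases hx : x ∈ K
    · have hxΩ := huΩ hx
      have hlap : ∑ i, f x * fderiv ℝ (fun y => fderiv ℝ v y (e i)) x (e i) =
          -(V x * u x ^ 2) := by
        rw [← Finset.mul_sum]
        change f x * laplacian N v x = _
        rw [eq_neg_of_add_eq_zero_left (hveq x hxΩ)]
        have := hvne x hxΩ
        simp only [hf]
        field_simp
      rw [Finset.sum_add_distrib, hlap, EuclideanSpace.norm_sq_dual_eq_sum,
        EuclideanSpace.norm_sq_dual_eq_sum, Finset.mul_sum,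
        Finset.sum_congr rfl fun i _ => sq_mul_fderiv_div_sq
          (hu2.differentiable (by norm_num) x) (hvD x hxΩ) (hvne x hxΩ) _,
        Finset.sum_sub_distrib]
      ring
    · simp [hdu0 x hx, hdf0 x hx, hdq0 x hx, hf0 x hx, hu0 x hx]
  have hoff {x : EN N} (hx : x ∉ Ω) : x ∉ K := fun h => hx (huΩ h)
  rw [setIntegral_eq_integral_of_forall_compl_eq_zero fun x hx => by simp [hdu0 x (hoff hx)],
    setIntegral_eq_integral_of_forall_compl_eq_zero fun x hx => by simp [hu0 x (hoff hx)],
    setIntegral_eq_integral_of_forall_compl_eq_zero fun x hx => by simp [hdq0 x (hoff hx)],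
    integral_congr_ae (ae_of_all _ key),
    integral_sub (by exact hdu_int.sub hVu_int) (integrable_finsetSum _ fun i _ => hdiv_int i),
    integral_sub hdu_int hVu_int, integral_finsetSum _ fun i _ => hdiv_int i]
  simp [parts]
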